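/- The series ∑_{n=0}^∞ (-1)^n · (binom(2n,n))^5 / 2^(20n) · (820n² + 180n + 13) converges and equals 128/π². -/

import Mathlib

/-- The rising factorial `(1/2)_n`. -/
noncomputable def gP : ℕ → ℝ
  | 0 => 1
  | n + 1 => gP n * (n + 1 / 2)

/-- The WZ companion along the `n` direction. -/
noncomputable def gG (n k : ℕ) : ℝ :=
  (-1) ^ n * gP n ^ 6 * gP k ^ 4 / ((2 * n).factorial * ((n + k).factorial : ℝ) ^ 4)
    * (20 * n ^ 2 + 8 * n + 1 + 24 * k * n + 8 * k ^ 2 + 4 * k)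

/-- The WZ companion along the `k` direction. -/
noncomputable def gF (n k : ℕ) : ℝ :=
  (-1) ^ n * gP n ^ 6 * gP k ^ 4 / ((2 * n).factorial * ((n + k).factorial : ℝ) ^ 4)
    * (8 * n * (2 * n + 1 + 4 * k))

theorem gP_pos (n : ℕ) : 0 < gP n := by
  induction n with
  | zero => simp [gP]
  | succ n ih => simp only [gP]; positivity

theorem gP_le (n : ℕ) : gP n ≤ n.factorial := by
  induction n with
  | zero => simp [gP]
  | succ n ih =>
    simp only [gP, Nat.factorial_succ]
    push_cast
    have : (0:ℝ) ≤ n := by positivity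
    have := gP_pos n
    nlinarith

theorem gP_eq (n : ℕ) : gP n * 4 ^ n * n.factorial = (2 * n).factorial := by
  induction n with
  | zero => simp [gP]
  | succ n ih =>
    rw [show 2 * (n + 1) = 2 * n + 1 + 1 by ring]
    simp only [gP, Nat.factorial_succ]
    push_cast
    rw [← ih]
    ring

theorem g_wz (n k : ℕ) : gF n k + gG n (k + 1) = gG n k + gF (n + 1) k := by
  unfold gF gG
  rw [show 2 * (n + 1) = 2 * n + 1 + 1 by ring, show n + 1 + k = n + k + 1 by ring,
    show n + (k + 1) = n + k + 1 by ring]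
  simp only [gP, Nat.factorial_succ]
  have h1 : ((2 * n).factorial : ℝ) ≠ 0 := by positivity
  have h2 : ((n + k).factorial : ℝ) ≠ 0 := by positivity
  have h3 : ((n : ℝ) + k + 1) ≠ 0 := by positivity
  have h4 : (2 * (n : ℝ) + 1) ≠ 0 := by positivity
  have h5 : (2 * (n : ℝ) + 1 + 1) ≠ 0 := by positivity
  push_cast
  field_simp
  ring

theorem g_F0 (k : ℕ) : gF 0 k = 0 := by simp [gF]

theorem g_row (N k : ℕ) :
    ∑ n ∈ Finset.range N, gG n (k + 1) = ∑ n ∈ Finset.range N, gG n k + gF N k := by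
  induction N with
  | zero => simp [g_F0]
  | succ N ih =>
    rw [Finset.sum_range_succ, Finset.sum_range_succ, ih]
    linarith [g_wz N k]

theorem g_diag (N : ℕ) :
    ∑ n ∈ Finset.range N, (gF n n + gG n (n + 1)) = ∑ n ∈ Finset.range N, gG n N := by
  induction N with
  | zero => simp
  | succ N ih =>
    rw [Finset.sum_range_succ, ih, Finset.sum_range_succ, g_row]
    ring

theorem g_term (n : ℕ) : (-1 : ℝ)^n * (Nat.choose (2*n) n : ℝ)^5 / 2^(20*n)
      * (820*n^2 + 180*n + 13) = 16 * (gF n n + gG n (n + 1)) := by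
  have hc : (Nat.choose (2*n) n : ℝ) = 16 ^ n * (gP n ^ 2 / (2 * n).factorial) := by
    have h := Nat.choose_mul_factorial_mul_factorial (show n ≤ 2 * n by omega)
    rw [show 2 * n - n = n by omega] at h
    have h' : (Nat.choose (2*n) n : ℝ) * n.factorial * n.factorial = (2 * n).factorial := by
      exact_mod_cast h
    have h1 : (n.factorial : ℝ) ≠ 0 := by positivity
    have h2 : ((2 * n).factorial : ℝ) ≠ 0 := by positivity
    have h16 : (16 : ℝ) ^ n = 4 ^ n * 4 ^ n := by rw [← mul_pow]; norm_num
    have hp := gP_eq n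
    rw [← mul_div_assoc, eq_div_iff h2]
    apply mul_right_cancel₀ (mul_ne_zero h1 h1)
    calc _ = (Nat.choose (2*n) n : ℝ) * n.factorial * n.factorial * (2 * n).factorial := by ring
      _ = (2 * n).factorial * (2 * n).factorial := by rw [h']
      _ = _ := by rw [← hp, h16]; ring
  have h20 : (2 : ℝ) ^ (20 * n) = (16 ^ n) ^ 5 := by
    rw [← pow_mul, mul_comm n 5, pow_mul, pow_mul]; norm_num
  rw [hc, h20]
  unfold gF gG
  rw [show n + (n + 1) = 2 * n + 1 by ring, show n + n = 2 * n by ring]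
  simp only [gP, Nat.factorial_succ]
  have h1 : ((2 * n).factorial : ℝ) ≠ 0 := by positivity
  have h4 : (2 * (n : ℝ) + 1) ≠ 0 := by positivity
  push_cast
  field_simp
  ring

theorem g_bound (m M : ℕ) (h : m + 1 ≤ M) : |gG (m + 1) M| ≤ 65 / (M : ℝ) ^ 2 := by
  have hM : (1 : ℝ) ≤ M := by exact_mod_cast (by omega : 1 ≤ M)
  have hM0 : (0 : ℝ) < M := by linarith
  have hmM : ((m : ℝ) + 1) ≤ M := by exact_mod_cast h
  have hm0 : (0 : ℝ) ≤ m := by positivity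
  have hp := gP_pos (m + 1)
  have hpM := gP_pos M
  -- polynomial factor
  have hq : (20 * ((m + 1 : ℕ) : ℝ) ^ 2 + 8 * ((m + 1 : ℕ) : ℝ) + 1 + 24 * M * ((m + 1 : ℕ) : ℝ)
      + 8 * (M : ℝ) ^ 2 + 4 * M) ≤ 65 * (M : ℝ) ^ 2 := by
    push_cast
    nlinarith
  have hf : ((m + 1).factorial : ℝ) ≤ (M : ℝ) ^ m := by
    have : ∀ j : ℕ, j + 1 ≤ M → (j + 1).factorial ≤ M ^ j := by
      intro j
      induction j with
      | zero => simp
      | succ j ih =>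
        intro hj
        rw [Nat.factorial_succ, pow_succ, mul_comm]
        exact Nat.mul_le_mul (ih (by omega)) hj
    exact_mod_cast this m h
  have hA : gP (m + 1) ^ 6 / (2 * (m + 1)).factorial ≤ ((M : ℝ) ^ m) ^ 4 := by
    rw [div_le_iff₀ (by positivity)]
    have h2 : ((m + 1).factorial : ℝ) ^ 2 ≤ (2 * (m + 1)).factorial := by
      have := Nat.le_of_dvd (Nat.factorial_pos _)
        (Nat.factorial_mul_factorial_dvd_factorial_add (m + 1) (m + 1))
      rw [← two_mul, ← sq] at this
      exact_mod_cast this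
    calc gP (m + 1) ^ 6 ≤ ((m + 1).factorial : ℝ) ^ 6 := by
          gcongr; exact gP_le _
      _ = ((m + 1).factorial : ℝ) ^ 4 * ((m + 1).factorial : ℝ) ^ 2 := by ring
      _ ≤ _ := by gcongr
  have hB : gP M / ((m + 1 + M).factorial : ℝ) ≤ 1 / (M : ℝ) ^ (m + 1) := by
    rw [div_le_div_iff₀ (by positivity) (by positivity), one_mul]
    have h3 : (M.factorial : ℝ) * (M : ℝ) ^ (m + 1) ≤ ((m + 1 + M).factorial : ℝ) := by
      have := @Nat.factorial_mul_pow_le_factorial M (m + 1)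
      rw [add_comm M (m + 1)] at this
      refine le_trans ?_ (by exact_mod_cast this :
        ((M.factorial : ℝ) * ((M : ℝ) + 1) ^ (m + 1)) ≤ ((m + 1 + M).factorial : ℝ))
      gcongr
      linarith
    refine le_trans ?_ h3
    gcongr
    exact gP_le M
  have e : |gG (m + 1) M| = gP (m + 1) ^ 6 / (2 * (m + 1)).factorial
      * (gP M / ((m + 1 + M).factorial : ℝ)) ^ 4
      * (20 * ((m + 1 : ℕ) : ℝ) ^ 2 + 8 * ((m + 1 : ℕ) : ℝ) + 1 + 24 * M * ((m + 1 : ℕ) : ℝ)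
      + 8 * (M : ℝ) ^ 2 + 4 * M) := by
    unfold gG
    rw [abs_mul, abs_div, abs_mul, abs_mul, abs_pow, abs_neg, abs_one, one_pow, one_mul,
      abs_of_pos (by positivity : 0 < gP (m + 1) ^ 6), abs_of_pos (by positivity : 0 < gP M ^ 4),
      abs_of_pos (by positivity : (0:ℝ) < (2 * (m + 1)).factorial * ((m + 1 + M).factorial : ℝ) ^ 4),
      abs_of_pos (by positivity)]
    ring
  rw [e]
  calc _ ≤ ((M : ℝ) ^ m) ^ 4 * (1 / (M : ℝ) ^ (m + 1)) ^ 4 * (65 * (M : ℝ) ^ 2) := by gcongr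
    _ = _ := by
      field_simp
      ring

theorem g_zero (N : ℕ) : gG 0 N
    = (1 / Real.Wallis.W N) ^ 2 * (2 - 2 * (1 / (2 * N + 1)) + (1 / (2 * (N : ℝ) + 1)) ^ 2) := by
  rw [Real.Wallis.W_eq_factorial_ratio, ← gP_eq N]
  have h1 : (N.factorial : ℝ) ≠ 0 := by positivity
  have h4 : (2 * (N : ℝ) + 1) ≠ 0 := by positivity
  have h5 := (gP_pos N).ne'
  have h16 : (2 : ℝ) ^ (4 * N) = 4 ^ N * 4 ^ N := by rw [pow_mul, ← mul_pow]; norm_num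
  rw [h16]
  unfold gG
  simp [gP]
  field_simp
  ring

open Filter Topology in
theorem g_tendsto : Tendsto (fun N => ∑ n ∈ Finset.range N, gG n N) atTop
    (𝓝 (8 / Real.pi ^ 2)) := by
  rw [← tendsto_add_atTop_iff_nat 1]
  have hsplit : ∀ N : ℕ, ∑ n ∈ Finset.range (N + 1), gG n (N + 1)
      = ∑ m ∈ Finset.range N, gG (m + 1) (N + 1) + gG 0 (N + 1) := fun N =>
    Finset.sum_range_succ' _ _
  simp_rw [hsplit]
  have hinv : Tendsto (fun N : ℕ => 1 / ((N : ℝ) + 1)) atTop (𝓝 0) :=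
    tendsto_one_div_add_atTop_nhds_zero_nat
  have htail : Tendsto (fun N : ℕ => ∑ m ∈ Finset.range N, gG (m + 1) (N + 1)) atTop (𝓝 0) := by
    refine squeeze_zero_norm (a := fun N : ℕ => 65 * (1 / ((N : ℝ) + 1))) ?_
      (by simpa using hinv.const_mul 65)
    intro N
    calc _ ≤ ∑ m ∈ Finset.range N, ‖gG (m + 1) (N + 1)‖ := norm_sum_le _ _
      _ ≤ ∑ m ∈ Finset.range N, 65 / ((N + 1 : ℕ) : ℝ) ^ 2 := by
        apply Finset.sum_le_sum
        intro m hm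
        exact g_bound m (N + 1) (by have := Finset.mem_range.1 hm; omega)
      _ = N * (65 / ((N : ℝ) + 1) ^ 2) := by simp
      _ ≤ ((N : ℝ) + 1) * (65 / ((N : ℝ) + 1) ^ 2) := by gcongr; linarith
      _ = _ := by field_simp
  have hinv2 : Tendsto (fun N : ℕ => 1 / (2 * (N : ℝ) + 1)) atTop (𝓝 0) := by
    refine squeeze_zero (fun N => by positivity) (fun N => ?_) hinv
    have : (0 : ℝ) ≤ N := by positivity
    gcongr
    linarith
  have hmain : Tendsto (fun N => gG 0 N) atTop (𝓝 (8 / Real.pi ^ 2)) := by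
    simp_rw [g_zero]
    have hW := ((tendsto_const_nhds (x := (1 : ℝ))).div Real.Wallis.tendsto_W_nhds_pi_div_two
      (by positivity)).pow 2
    have := hW.mul (((hinv2.const_mul 2).const_sub 2).add (hinv2.pow 2))
    have e : (1 / (Real.pi / 2)) ^ 2 * (2 - 2 * 0 + 0 ^ 2) = 8 / Real.pi ^ 2 := by
      have := Real.pi_ne_zero
      field_simp
      norm_num
    rw [e] at this
    exact this
  have := htail.add ((tendsto_add_atTop_iff_nat 1).2 hmain)
  simpa using this

theorem g_summable : Summable (fun n : ℕ => (-1 : ℝ)^n * (Nat.choose (2*n) n : ℝ)^5 / 2^(20*n)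
      * (820*n^2 + 180*n + 13)) := by
  have hr : ‖(1 / 1024 : ℝ)‖ < 1 := by norm_num
  have s2 := (summable_pow_mul_geometric_of_norm_lt_one 2 hr).mul_left 820
  have s1 := (summable_pow_mul_geometric_of_norm_lt_one 1 hr).mul_left 180
  have s0 := (summable_pow_mul_geometric_of_norm_lt_one 0 hr).mul_left 13
  refine Summable.of_norm_bounded ((s2.add s1).add s0) ?_
  intro n
  have hc : (Nat.choose (2*n) n : ℝ) ≤ 4 ^ n := by
    exact_mod_cast Nat.centralBinom_le_four_pow n
  rw [norm_mul, norm_div, norm_mul, norm_pow, norm_neg, norm_one, one_pow, one_mul,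
    Real.norm_of_nonneg (by positivity), Real.norm_of_nonneg (by positivity),
    Real.norm_of_nonneg (by positivity)]
  have h20 : (2 : ℝ) ^ (20 * n) = (4 ^ n) ^ 5 * 1024 ^ n := by
    rw [← pow_mul, mul_comm n 5, pow_mul, pow_mul, ← mul_pow]; norm_num
  have key : (Nat.choose (2*n) n : ℝ) ^ 5 / 2 ^ (20 * n) ≤ (1 / 1024) ^ n := by
    rw [h20, div_le_iff₀ (by positivity)]
    calc _ ≤ ((4 : ℝ) ^ n) ^ 5 := by gcongr
      _ = _ := by rw [one_div, inv_pow]; field_simp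
  calc _ ≤ (1 / 1024 : ℝ) ^ n * (820*n^2 + 180*n + 13) := by gcongr
    _ = _ := by ring

theorem guillera_first_pi_squared :
    HasSum (fun n : ℕ => (-1 : ℝ)^n * (Nat.choose (2*n) n : ℝ)^5 / 2^(20*n)
      * (820*n^2 + 180*n + 13)) (128 / Real.pi^2) := by
  rw [g_summable.hasSum_iff_tendsto_nat]
  simp_rw [g_term, ← Finset.mul_sum, g_diag]
  convert g_tendsto.const_mul 16 using 2
  ring
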